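/- Let s₁,…,s_m be subsets of the n sites, let H = Σᵢ₌₁^m lift(hᵢ,sᵢ) where each hᵢ is a Hermitian matrix indexed by (sᵢ → Fin 2), and let ψ be a unit vector that is the unique ground state of H with ground energy λ and spectral gap at least Δ > 0. Then ψψ† is UDA by its reduced density matrices on s₁,…,s_m: every n-qubit density matrix ρ with ρ_{sᵢ} = (ψψ†)_{sᵢ} for all i satisfies ρ = ψψ†. -/

import Mathlib

open Matrix
open scoped ComplexOrder

/-- The type of configurations of `n` qubits. -/
abbrev QConf (n : ℕ) := Fin n → Fin 2

/-- An `n`-qubit matrix. -/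
abbrev QMatrix (n : ℕ) := Matrix (QConf n) (QConf n) ℂ

/-- Combine a configuration `f` on the sites in `s` with a configuration `h` on the
complementary sites into a configuration on all `n` sites. -/
def mergeConf {n : ℕ} (s : Finset (Fin n)) (f : ↥s → Fin 2) (h : ↥sᶜ → Fin 2) :
    QConf n :=
  fun i => if hi : i ∈ s then f ⟨i, hi⟩ else h ⟨i, Finset.mem_compl.mpr hi⟩

/-- The reduced density matrix of an `n`-qubit matrix `ρ` on the subset `s` of sites
(partial trace over the complement of `s`). -/
noncomputable def reduce {n : ℕ} (ρ : QMatrix n) (s : Finset (Fin n)) :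
    Matrix (↥s → Fin 2) (↥s → Fin 2) ℂ :=
  fun f g => ∑ h : ↥sᶜ → Fin 2, ρ (mergeConf s f h) (mergeConf s g h)

/-- The lift of a matrix `h` on the sites in `s` to an `n`-qubit matrix:
`h` tensored with the identity on the complement of `s`. -/
def liftMat {n : ℕ} (s : Finset (Fin n)) (h : Matrix (↥s → Fin 2) (↥s → Fin 2) ℂ) :
    QMatrix n :=
  fun F G =>
    if ∀ i : ↥sᶜ, F i = G i then h (fun i : ↥s => F i) (fun i : ↥s => G i) else 0

/-- Merging a configuration on `s` with one on `sᶜ` is a bijection. -/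
def mergeConfEquiv {n : ℕ} (s : Finset (Fin n)) :
    (↥s → Fin 2) × (↥sᶜ → Fin 2) ≃ QConf n where
  toFun p := mergeConf s p.1 p.2
  invFun F := (fun i => F i, fun i => F i)
  left_inv := by
    rintro ⟨f, h⟩
    ext i
    · simp [mergeConf]
    · simp [mergeConf, Finset.mem_compl.mp i.2]
  right_inv F := by
    ext i
    simp [mergeConf]

theorem liftMat_mergeConf {n : ℕ} (s : Finset (Fin n))
    (h : Matrix (↥s → Fin 2) (↥s → Fin 2) ℂ) (f g : ↥s → Fin 2) (u w : ↥sᶜ → Fin 2) :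
    liftMat s h (mergeConf s f u) (mergeConf s g w) = if u = w then h f g else 0 := by
  have hs (f : ↥s → Fin 2) (u : ↥sᶜ → Fin 2) : (fun i : ↥s => mergeConf s f u i) = f :=
    congrArg Prod.fst ((mergeConfEquiv s).left_inv (f, u))
  have hc (f : ↥s → Fin 2) (u : ↥sᶜ → Fin 2) (i : ↥sᶜ) : mergeConf s f u i = u i :=
    congrFun (congrArg Prod.snd ((mergeConfEquiv s).left_inv (f, u))) i
  simp only [liftMat, hs, hc, funext_iff]

/-- Expectations of a lifted observable only depend on the reduced density matrix. -/
theorem trace_liftMat_mul {n : ℕ} (s : Finset (Fin n))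
    (h : Matrix (↥s → Fin 2) (↥s → Fin 2) ℂ) (ρ : QMatrix n) :
    (liftMat s h * ρ).trace = (h * reduce ρ s).trace := by
  simp only [Matrix.trace, Matrix.diag_apply, Matrix.mul_apply, reduce]
  rw [← (mergeConfEquiv s).sum_comp, Fintype.sum_prod_type]
  refine Finset.sum_congr rfl fun f _ => ?_
  simp only [← (mergeConfEquiv s).sum_comp (fun G => liftMat s h _ G * ρ G _),
    Fintype.sum_prod_type, Finset.mul_sum]
  simp only [mergeConfEquiv, Equiv.coe_fn_mk, liftMat_mergeConf, ite_mul, zero_mul,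
    Finset.sum_ite_eq, Finset.mem_univ, if_true]
  exact Finset.sum_comm

theorem liftMat_isHermitian {n : ℕ} (s : Finset (Fin n))
    {h : Matrix (↥s → Fin 2) (↥s → Fin 2) ℂ} (hh : h.IsHermitian) :
    (liftMat s h).IsHermitian := by
  ext F G
  simp only [Matrix.conjTranspose_apply, liftMat, eq_comm (a := G _)]
  split_ifs
  · exact hh.apply _ _
  · simp

section Gap

variable {ι : Type*} [Fintype ι]

theorem re_star_dotProduct_self_nonneg (v : ι → ℂ) : 0 ≤ (star v ⬝ᵥ v).re :=
  (Complex.le_def.mp (dotProduct_star_self_nonneg v)).1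

/-- The energy of a vector exceeds the ground energy by at least the gap times the squared
norm of its component orthogonal to the ground state. -/
theorem energy_ge_of_gap {H : Matrix ι ι ℂ} (hH : H.IsHermitian)
    {ψ : ι → ℂ} (hψ : star ψ ⬝ᵥ ψ = 1) {lam Δ : ℝ} (hground : H *ᵥ ψ = (lam : ℂ) • ψ)
    (hgap : ∀ v : ι → ℂ, star ψ ⬝ᵥ v = 0 →
      (lam + Δ) * (star v ⬝ᵥ v).re ≤ (star v ⬝ᵥ (H *ᵥ v)).re) (a : ι → ℂ) :
    lam * (star a ⬝ᵥ a).re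
      + Δ * (star (a - (star ψ ⬝ᵥ a) • ψ) ⬝ᵥ (a - (star ψ ⬝ᵥ a) • ψ)).re
      ≤ (star a ⬝ᵥ (H *ᵥ a)).re := by
  obtain ⟨c, hc⟩ : ∃ c, c = star ψ ⬝ᵥ a := ⟨_, rfl⟩
  obtain ⟨v, hv⟩ : ∃ v, v = a - c • ψ := ⟨_, rfl⟩
  have hψv : star ψ ⬝ᵥ v = 0 := by
    rw [hv, dotProduct_sub, dotProduct_smul, hψ, ← hc]
    simp
  have hvψ : star v ⬝ᵥ ψ = 0 := by
    have := congrArg star hψv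
    rwa [star_dotProduct, star_star, star_zero] at this
  have hψHv : star ψ ⬝ᵥ (H *ᵥ v) = 0 := by
    have : star ψ ᵥ* H = (lam : ℂ) • star ψ := by
      have := congrArg star hground
      rw [star_mulVec, hH.eq] at this
      rw [this]
      ext i
      simp
    rw [dotProduct_mulVec, this, smul_dotProduct, hψv, smul_zero]
  have ha : a = c • ψ + v := by rw [hv]; abel
  rw [← hc, ← hv]
  have h1 : star a ⬝ᵥ a = star c * c + star v ⬝ᵥ v := by
    rw [ha]
    simp [add_dotProduct, dotProduct_add, hψ, hψv, hvψ, mul_comm]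
  have h2 : star a ⬝ᵥ (H *ᵥ a) = lam * (star c * c) + star v ⬝ᵥ (H *ᵥ v) := by
    rw [ha]
    simp only [star_add, star_smul, mulVec_add, mulVec_smul, hground, add_dotProduct,
      dotProduct_add, smul_dotProduct, dotProduct_smul, hψ, hvψ, hψHv, smul_eq_mul]
    ring
  have h3 := hgap v hψv
  rw [h1, h2, Complex.add_re, Complex.add_re, Complex.re_ofReal_mul]
  linarith

open scoped MatrixOrder in
/-- A density matrix whose energy equals the ground energy of a gapped Hamiltonian with a
unique ground state is the projector onto the ground state. -/
theorem eq_vecMulVec_of_energy_eq [DecidableEq ι] {H : Matrix ι ι ℂ} (hH : H.IsHermitian)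
    {ψ : ι → ℂ} (hψ : star ψ ⬝ᵥ ψ = 1) {lam Δ : ℝ} (hΔ : 0 < Δ)
    (hground : H *ᵥ ψ = (lam : ℂ) • ψ)
    (hgap : ∀ v : ι → ℂ, star ψ ⬝ᵥ v = 0 →
      (lam + Δ) * (star v ⬝ᵥ v).re ≤ (star v ⬝ᵥ (H *ᵥ v)).re)
    {ρ : Matrix ι ι ℂ} (hρ : ρ.PosSemidef) (hρtr : ρ.trace = 1)
    (henergy : (H * ρ).trace = lam) :
    ρ = vecMulVec ψ (star ψ) := by
  obtain ⟨B, rfl⟩ : ∃ B : Matrix ι ι ℂ, ρ = Bᴴ * B :=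
    CStarAlgebra.nonneg_iff_eq_star_mul_self.mp hρ.nonneg
  let a (k : ι) : ι → ℂ := star (B k)
  let c (k : ι) : ℂ := star ψ ⬝ᵥ a k
  have htr : ∑ k, star (a k) ⬝ᵥ a k = 1 := by
    rw [← hρtr, Matrix.trace_mul_comm]
    simp only [a, star_star]
    rfl
  have hen : ∑ k, star (a k) ⬝ᵥ (H *ᵥ a k) = lam := by
    rw [← henergy, ← Matrix.mul_assoc, Matrix.trace_mul_comm]
    simp only [a, star_star]
    rfl
  have hsum : Δ * ∑ k, (star (a k - c k • ψ) ⬝ᵥ (a k - c k • ψ)).re ≤ 0 := by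
    have h := Finset.sum_le_sum fun k (_ : k ∈ Finset.univ) =>
      energy_ge_of_gap hH hψ hground hgap (a k)
    have htr' := congrArg Complex.re htr
    have hen' := congrArg Complex.re hen
    rw [Complex.re_sum, Complex.one_re] at htr'
    rw [Complex.re_sum, Complex.ofReal_re] at hen'
    rw [Finset.sum_add_distrib, ← Finset.mul_sum, ← Finset.mul_sum, htr', hen'] at h
    linarith
  have hzero : ∑ k, (star (a k - c k • ψ) ⬝ᵥ (a k - c k • ψ)).re = 0 :=
    le_antisymm (nonpos_of_mul_nonpos_right hsum hΔ)
      (Finset.sum_nonneg fun k _ => re_star_dotProduct_self_nonneg _)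
  have ha (k : ι) : a k = c k • ψ := by
    have h0 := (Finset.sum_eq_zero_iff_of_nonneg
      fun k _ => re_star_dotProduct_self_nonneg _).mp hzero k (Finset.mem_univ k)
    have him := (Complex.le_def.mp (dotProduct_star_self_nonneg (a k - c k • ψ))).2
    exact sub_eq_zero.mp (dotProduct_star_self_eq_zero.mp (Complex.ext h0 him.symm))
  have hc : ∑ k, c k * star (c k) = 1 := by
    rw [← htr]
    refine Finset.sum_congr rfl fun k _ => ?_
    rw [ha k]
    simp [hψ, mul_comm]
  have hB (k i : ι) : B k i = star (c k) * star (ψ i) := by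
    have := congrArg star (congrFun (ha k) i)
    simpa [a, mul_comm] using this
  ext i j
  rw [Matrix.mul_apply, vecMulVec_apply, ← one_mul (ψ i * _), ← hc, Finset.sum_mul]
  refine Finset.sum_congr rfl fun k _ => ?_
  rw [conjTranspose_apply, hB, hB, Pi.star_apply]
  simp only [star_mul', star_star]
  ring

end Gap

/-- If `ψ` is the unique ground state of a local Hamiltonian
`H = Σᵢ lift(hᵢ,sᵢ)` with Hermitian terms, ground energy `lam` and spectral gap at
least `Δ > 0`, then `ψψ†` is UDA by its reduced density matrices on `s 0, …, s (m-1)`: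
every `n`-qubit density matrix with the same reduced density matrices equals `ψψ†`. -/
theorem UDA_of_unique_ground_state
    (n m : ℕ) (s : Fin m → Finset (Fin n))
    (hmat : ∀ i, Matrix (↥(s i) → Fin 2) (↥(s i) → Fin 2) ℂ)
    (hHerm : ∀ i, (hmat i).IsHermitian)
    (ψ : QConf n → ℂ) (hψ : star ψ ⬝ᵥ ψ = 1)
    (lam Δ : ℝ) (hΔ : 0 < Δ)
    (hground : (∑ i, liftMat (s i) (hmat i)) *ᵥ ψ = (lam : ℂ) • ψ)
    (hgap : ∀ v : QConf n → ℂ, star ψ ⬝ᵥ v = 0 →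
      (lam + Δ) * (star v ⬝ᵥ v).re ≤ (star v ⬝ᵥ ((∑ i, liftMat (s i) (hmat i)) *ᵥ v)).re)
    (ρ : QMatrix n) (hρ : ρ.PosSemidef) (hρtr : ρ.trace = 1)
    (hmarg : ∀ i, reduce ρ (s i) = reduce (vecMulVec ψ (star ψ)) (s i)) :
    ρ = vecMulVec ψ (star ψ) := by
  have hH : (∑ i, liftMat (s i) (hmat i)).IsHermitian :=
    isSelfAdjoint_sum _ fun i _ => liftMat_isHermitian (s i) (hHerm i)
  refine eq_vecMulVec_of_energy_eq hH hψ hΔ hground hgap hρ hρtr ?_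
  have hlocal : ((∑ i, liftMat (s i) (hmat i)) * ρ).trace
      = ((∑ i, liftMat (s i) (hmat i)) * vecMulVec ψ (star ψ)).trace := by
    simp only [Finset.sum_mul, trace_sum, trace_liftMat_mul, hmarg]
  rw [hlocal, mul_vecMulVec, hground, trace_vecMulVec, smul_dotProduct, dotProduct_comm, hψ,
    smul_eq_mul, mul_one]
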